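/- Let q = 2^n be a power of 2, and let ℓ be a prime and r ≥ 1 an integer such that SL_2(F_q) contains an element of order ℓ^r. If q ≡ 1 (mod ℓ^r) or q ≡ −1 (mod ℓ^r), then K_{ℓ^r}(SL_2(F_q)) = ℚ(ζ_{ℓ^r} + ζ_{ℓ^r}^{−1}); if q ≡ 0 (mod ℓ^r), then K_{ℓ^r}(SL_2(F_q)) = ℚ. -/

import Mathlib

open CategoryTheory

/-- `zeta N` is the root of unity `e^{2 π i / N}`. -/
noncomputable def zeta (N : ℕ) : ℂ := Complex.exp (2 * Real.pi * Complex.I / N)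

/-- `charField G` is the field `K(G)` generated over `ℚ` by all values of
irreducible complex characters of `G`. -/
noncomputable def charField (G : Type) [Group G] : IntermediateField ℚ ℂ :=
  IntermediateField.adjoin ℚ
    {x : ℂ | ∃ V : FDRep ℂ G, Simple V ∧ ∃ g : G, V.character g = x}

/-- `charFieldAt G d` is the field `K_d(G)` generated over `ℚ` by the values of
irreducible complex characters of `G` at elements of order exactly `d`. -/
noncomputable def charFieldAt (G : Type) [Group G] (d : ℕ) : IntermediateField ℚ ℂ :=
  IntermediateField.adjoin ℚ
    {x : ℂ | ∃ V : FDRep ℂ G, Simple V ∧ ∃ g : G, orderOf g = d ∧ V.character g = x}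

section CharacterFields

variable {G : Type} [Group G]

/-- The trace is additive along a decomposition into complementary invariant submodules. -/
theorem trace_eq_add_trace_restrict {K V : Type*} [Field K] [AddCommGroup V] [Module K V]
    [FiniteDimensional K V] {p q : Submodule K V} (h : IsCompl p q) (f : V →ₗ[K] V)
    (hp : ∀ x ∈ p, f x ∈ p) (hq : ∀ x ∈ q, f x ∈ q) :
    LinearMap.trace K V f =
      LinearMap.trace K p (f.restrict hp) + LinearMap.trace K q (f.restrict hq) := by
  have hI : DirectSum.IsInternal (fun b : Bool => cond b p q) :=
    (DirectSum.isInternal_submodule_iff_isCompl _ (i := true) (j := false) (by decide)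
      (by ext b; cases b <;> simp)).2 h
  have hmaps : ∀ b : Bool, Set.MapsTo f (cond b p q : Submodule K V)
      (cond b p q : Submodule K V) := by
    rintro (_ | _)
    exacts [hq, hp]
  have (b : Bool) : Module.Finite K (cond b p q : Submodule K V) := inferInstance
  have (b : Bool) : Module.Free K (cond b p q : Submodule K V) := inferInstance
  rw [LinearMap.trace_eq_sum_trace_restrict hI hmaps, Fintype.sum_bool]
  rfl

theorem simple_of_isIrreducible [Finite G] {V : Type} [AddCommGroup V] [Module ℂ V]
    [FiniteDimensional ℂ V] (ρ : Representation ℂ G V) [ρ.IsIrreducible] :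
    Simple (FDRep.of ρ) := by
  rw [FDRep.simple_iff_end_is_rank_one]
  rw [← (FDRep.forget₂HomLinearEquiv (FDRep.of ρ) (FDRep.of ρ)).finrank_eq,
    (Rep.homLinearEquiv _ _).finrank_eq]
  exact Representation.IsIrreducible.finrank_intertwiningMap_self ρ

/-- The character field at `d` contains the values at elements of order `d` of the characters of
all finite-dimensional representations, irreducible or not. -/
theorem trace_mem_charFieldAt [Finite G] (g : G) (V : Type) [AddCommGroup V] [Module ℂ V]
    [FiniteDimensional ℂ V] (ρ : Representation ℂ G V) :
    LinearMap.trace ℂ V (ρ g) ∈ charFieldAt G (orderOf g) := by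
  induction hN : Module.finrank ℂ V using Nat.strong_induction_on generalizing V with
  | _ N ih =>
  by_cases hV : Subsingleton V
  · rw [Subsingleton.elim (ρ g) 0, map_zero]
    exact zero_mem _
  rw [not_subsingleton_iff_nontrivial] at hV
  by_cases hirr : ρ.IsIrreducible
  · exact IntermediateField.subset_adjoin ℚ _
      ⟨FDRep.of ρ, simple_of_isIrreducible ρ, g, rfl, rfl⟩
  have hnt : Nontrivial (Subrepresentation ρ) := by
    refine ⟨⊥, ⊤, fun h => ?_⟩
    exact bot_ne_top (α := Submodule ℂ V) (congrArg Subrepresentation.toSubmodule h)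
  obtain ⟨p, hp0, hp1⟩ : ∃ p : Subrepresentation ρ, p ≠ ⊥ ∧ p ≠ ⊤ := by
    by_contra! h
    exact hirr ⟨fun p => or_iff_not_imp_left.2 (h p)⟩
  obtain ⟨q, hpq⟩ := exists_isCompl p
  have hcompl : IsCompl p.toSubmodule q.toSubmodule := by
    refine IsCompl.of_eq ?_ ?_
    · exact congrArg Subrepresentation.toSubmodule hpq.inf_eq_bot
    · exact congrArg Subrepresentation.toSubmodule hpq.sup_eq_top
  have hp1' : p.toSubmodule ≠ ⊤ := fun h => hp1 (Subrepresentation.toSubmodule_injective h)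
  have hq1' : q.toSubmodule ≠ ⊤ := fun h => by
    refine hp0 (Subrepresentation.toSubmodule_injective ?_)
    have := hcompl.inf_eq_bot
    rwa [h, inf_top_eq] at this
  rw [trace_eq_add_trace_restrict hcompl (ρ g) (p.apply_mem_toSubmodule g)
    (q.apply_mem_toSubmodule g)]
  subst hN
  exact add_mem (ih _ (Submodule.finrank_lt hp1') _ p.toRepresentation rfl)
    (ih _ (Submodule.finrank_lt hq1') _ q.toRepresentation rfl)

theorem zeta_isPrimitiveRoot {m : ℕ} (hm : m ≠ 0) : IsPrimitiveRoot (zeta m) m :=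
  Complex.isPrimitiveRoot_exp m hm

theorem pow_add_inv_pow_mem {S K : Type*} [Field K] [SetLike S K] [SubringClass S K] (L : S)
    {z : K} (hz : z ≠ 0) (h : z + z⁻¹ ∈ L) (a : ℕ) : z ^ a + (z ^ a)⁻¹ ∈ L := by
  induction a using Nat.twoStepInduction with
  | zero => simpa using add_mem (one_mem L) (one_mem L)
  | one => simpa using h
  | more a h0 h1 =>
    have : z ^ (a + 2) + (z ^ (a + 2))⁻¹ =
        (z + z⁻¹) * (z ^ (a + 1) + (z ^ (a + 1))⁻¹) - (z ^ a + (z ^ a)⁻¹) := by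
      field_simp
      ring
    rw [this]
    exact sub_mem (mul_mem h h1) h0

theorem trace_mem_of_forall_hasEigenvalue {V : Type*} [AddCommGroup V] [Module ℂ V]
    [FiniteDimensional ℂ V] (L : IntermediateField ℚ ℂ) (f : Module.End ℂ V)
    (h : ∀ μ, f.HasEigenvalue μ → μ ∈ L) : LinearMap.trace ℂ V f ∈ L := by
  rw [Module.End.trace_eq_sum_roots_charpoly_of_splits (IsAlgClosed.splits _)]
  refine multiset_sum_mem _ fun μ hμ => h μ ?_
  rw [Module.End.hasEigenvalue_iff_isRoot_charpoly]
  exact Polynomial.isRoot_of_mem_roots hμ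

/-- A character value at `g` that agrees with the value at `g⁻¹` is a polynomial in
`ζ + ζ⁻¹`, where `ζ` is a primitive root of unity of order a period of `g`. -/
theorem character_mem_adjoin_zeta_add_inv (V : FDRep ℂ G) {g : G} {m : ℕ} (hm : m ≠ 0)
    (hg : g ^ m = 1) (hreal : V.character g⁻¹ = V.character g) :
    V.character g ∈ IntermediateField.adjoin ℚ {zeta m + (zeta m)⁻¹} := by
  set L := IntermediateField.adjoin ℚ {zeta m + (zeta m)⁻¹}
  have := NeZero.mk hm
  have hζ := zeta_isPrimitiveRoot hm
  have hpow : g ^ (m - 1) = g⁻¹ :=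
    eq_inv_of_mul_eq_one_left (by rw [← pow_succ, Nat.sub_one_add_one hm, hg])
  let T : Module.End ℂ V := V.ρ g
  have hT : T ^ m = 1 := by rw [← map_pow, hg, map_one]
  let P : Polynomial ℂ := Polynomial.X + Polynomial.X ^ (m - 1)
  have htrace : LinearMap.trace ℂ V (Polynomial.aeval T P) = 2 * V.character g := by
    have : Polynomial.aeval T P = V.ρ g + V.ρ g⁻¹ := by
      simp [P, T, ← hpow]
    rw [this, map_add, two_mul]
    exact congrArg (V.character g + ·) hreal
  have hmem : LinearMap.trace ℂ V (Polynomial.aeval T P) ∈ L := by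
    refine trace_mem_of_forall_hasEigenvalue L _ fun μ hμ => ?_
    have : Nontrivial (V : Type) := ⟨_, _, hμ.exists_hasEigenvector.choose_spec.2⟩
    have hμ' := Module.End.hasEigenvalue_iff_mem_spectrum.1 hμ
    rw [spectrum.map_polynomial_aeval_of_nonempty T P
      (spectrum.nonempty_of_isAlgClosed_of_finiteDimensional ℂ T)] at hμ'
    obtain ⟨ν, hν, rfl⟩ := hμ'
    obtain ⟨v, hv⟩ := (Module.End.hasEigenvalue_iff_mem_spectrum.2 hν).exists_hasEigenvector
    have hνm : ν ^ m = 1 := by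
      have := hv.pow_apply m
      rw [hT, Module.End.one_apply] at this
      refine smul_left_injective ℂ hv.2 ?_
      simpa using this.symm
    obtain ⟨a, -, rfl⟩ := hζ.eq_pow_of_pow_eq_one hνm
    have hinv : (zeta m ^ a) ^ (m - 1) = (zeta m ^ a)⁻¹ :=
      eq_inv_of_mul_eq_one_left (by rw [← pow_succ, Nat.sub_one_add_one hm, hνm])
    have := pow_add_inv_pow_mem L (hζ.ne_zero hm)
      (IntermediateField.subset_adjoin ℚ _ (Set.mem_singleton _)) a
    simpa [P, hinv] using this
  rw [htrace] at hmem
  have := mul_mem (inv_mem (ofNat_mem L 2)) hmem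
  rwa [inv_mul_cancel_left₀ two_ne_zero] at this

/-- If every element of order `m` is conjugate to its inverse, the character field at `m` is
contained in `ℚ(ζ_m + ζ_m⁻¹)`. -/
theorem charFieldAt_le {m : ℕ} (hm : m ≠ 0)
    (hreal : ∀ g : G, orderOf g = m → ∃ h : G, h * g * h⁻¹ = g⁻¹) :
    charFieldAt G m ≤ IntermediateField.adjoin ℚ {zeta m + (zeta m)⁻¹} := by
  refine IntermediateField.adjoin_le_iff.2 ?_
  rintro _ ⟨V, -, g, hg, rfl⟩
  obtain ⟨h, hh⟩ := hreal g hg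
  refine character_mem_adjoin_zeta_add_inv V hm (hg ▸ pow_orderOf_eq_one g) ?_
  rw [← hh, V.char_conj]

variable (G) in
/-- The representation of `G` on complex functions on `G` by right translation. -/
def rightTranslation : Representation ℂ G (G → ℂ) where
  toFun h := LinearMap.funLeft ℂ ℂ (· * h)
  map_one' := by ext; simp [LinearMap.funLeft]
  map_mul' a b := by ext; simp [LinearMap.funLeft, mul_assoc]

@[simp]
theorem rightTranslation_apply (h : G) (f : G → ℂ) (x : G) :
    rightTranslation G h f x = f (x * h) := rfl

/-- The subrepresentation of functions on `G` that are scaled by `z` under left translation by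
`g`. For `z` of the same order as `g`, this is the representation induced from the character
`g ↦ z` of the cyclic subgroup generated by `g`. -/
def equivariantFunctions (g : G) (z : ℂ) : Subrepresentation (rightTranslation G) where
  toSubmodule :=
    { carrier := {f | ∀ x, f (g * x) = z * f x}
      add_mem' := fun ha hb x => by simp [ha x, hb x, mul_add]
      zero_mem' := fun x => by simp
      smul_mem' := fun c f hf x => by simp [hf x, mul_left_comm] }
  apply_mem_toSubmodule h f hf x := by
    simpa [mul_assoc] using hf (x * h)

theorem mem_equivariantFunctions {g : G} {z : ℂ} {f : G → ℂ} :
    f ∈ (equivariantFunctions g z).toSubmodule ↔ ∀ x, f (g * x) = z * f x := Iff.rfl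

theorem apply_pow_mul_of_mem_equivariantFunctions {g : G} {z : ℂ} {f : G → ℂ}
    (hf : f ∈ (equivariantFunctions g z).toSubmodule) (j : ℕ) (x : G) :
    f (g ^ j * x) = z ^ j * f x := by
  induction j with
  | zero => simp
  | succ j ih =>
    rw [pow_succ', mul_assoc, mem_equivariantFunctions.1 hf, ih, pow_succ', mul_assoc]

/-- The trace of an endomorphism of a space of functions on a finite set. -/
theorem trace_pi_eq_sum {ι K : Type*} [Fintype ι] [DecidableEq ι] [Field K]
    (T : (ι → K) →ₗ[K] (ι → K)) :
    LinearMap.trace K (ι → K) T = ∑ x, T (Pi.single x 1) x := by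
  rw [LinearMap.trace_eq_matrix_trace K (Pi.basisFun K ι)]
  simp [Matrix.trace]

/-- The character of `equivariantFunctions g z`, where `m` is a common period of `g` and `z`. -/
theorem trace_equivariantFunctions [Fintype G] [DecidableEq G] {g : G} {z : ℂ} {m : ℕ}
    (hm : m ≠ 0) (hg : g ^ m = 1) (hz : z ^ m = 1) (h : G) :
    LinearMap.trace ℂ _ ((equivariantFunctions g z).toRepresentation h) =
      (m : ℂ)⁻¹ * ∑ x : G, ∑ j ∈ Finset.range m, if g ^ j * (x * h) = x then (z ^ j)⁻¹ else 0 := by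
  have hz0 : z ≠ 0 := by
    rintro rfl
    simp [hm] at hz
  have hm0 : (m : ℂ) ≠ 0 := Nat.cast_ne_zero.2 hm
  let E : (G → ℂ) →ₗ[ℂ] (G → ℂ) :=
    (m : ℂ)⁻¹ • ∑ j ∈ Finset.range m, (z ^ j)⁻¹ • LinearMap.funLeft ℂ ℂ (fun x => g ^ j * (x * h))
  have hE (f : G → ℂ) (x : G) : E f x =
      (m : ℂ)⁻¹ * ∑ j ∈ Finset.range m, (z ^ j)⁻¹ * f (g ^ j * (x * h)) := by
    simp [E, LinearMap.funLeft]
  have hrange (f : G → ℂ) : E f ∈ (equivariantFunctions g z).toSubmodule := by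
    intro x
    let a (j : ℕ) : ℂ := (z ^ j)⁻¹ * f (g ^ j * (x * h))
    have hshift : ∑ j ∈ Finset.range m, a (j + 1) = ∑ j ∈ Finset.range m, a j := by
      have h0 : a m = a 0 := by simp [a, hg, hz]
      have := (Finset.sum_range_succ a m).symm.trans (Finset.sum_range_succ' a m)
      rw [h0] at this
      exact (add_right_cancel this).symm
    rw [hE, hE, mul_left_comm, ← hshift, Finset.mul_sum _ _ z]
    congr 1
    refine Finset.sum_congr rfl fun j _ => ?_
    simp only [a, pow_succ, mul_assoc]
    field_simp
  have hrestrict : (equivariantFunctions g z).toRepresentation h =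
      E.restrict (fun f _ => hrange f) := by
    apply LinearMap.ext
    rintro ⟨f, hf⟩
    apply Subtype.ext
    funext x
    change f (x * h) = E f x
    have hterm (j : ℕ) : (z ^ j)⁻¹ * f (g ^ j * (x * h)) = f (x * h) := by
      rw [apply_pow_mul_of_mem_equivariantFunctions hf, inv_mul_cancel_left₀ (pow_ne_zero _ hz0)]
    simp [hE, hterm, hm0]
  rw [hrestrict, LinearMap.trace_restrict_eq_of_forall_mem _ E hrange, trace_pi_eq_sum,
    Finset.mul_sum]
  refine Finset.sum_congr rfl fun x _ => ?_
  simp [hE, Pi.single_apply]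

/-- If `g` has order `m > 2`, is conjugate to its inverse, and is conjugate to no other of its
powers, then `ζ_m + ζ_m⁻¹` lies in the character field at `m`. -/
theorem zeta_add_inv_mem_charFieldAt [Finite G] {g h : G} (hm : 2 < orderOf g)
    (hreal : h * g * h⁻¹ = g⁻¹)
    (hpow : ∀ (x : G) (j : ℕ), x * g * x⁻¹ = g ^ j → g ^ j = g ∨ g ^ j = g⁻¹) :
    zeta (orderOf g) + (zeta (orderOf g))⁻¹ ∈ charFieldAt G (orderOf g) := by
  classical
  have := Fintype.ofFinite G
  set m := orderOf g
  have hm0 : m ≠ 0 := by lia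
  have hζ := zeta_isPrimitiveRoot hm0
  set z := zeta m
  have hgm : g ^ m = 1 := pow_orderOf_eq_one g
  have hginv : g ^ (m - 1) = g⁻¹ :=
    eq_inv_of_mul_eq_one_left (by rw [← pow_succ, Nat.sub_one_add_one hm0, hgm])
  have hzinv : (z ^ (m - 1))⁻¹ = z := by
    rw [inv_eq_iff_eq_inv]
    exact eq_inv_of_mul_eq_one_left
      (by rw [← pow_succ, Nat.sub_one_add_one hm0, hζ.pow_eq_one])
  have hne : g ≠ g⁻¹ := by
    intro h
    have : g ^ 2 = 1 := by rw [pow_two, ← eq_inv_iff_mul_eq_one]; exact h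
    exact absurd (Nat.le_of_dvd two_pos (orderOf_dvd_of_pow_eq_one this)) (by lia)
  have hinj {i j : ℕ} (hi : i < m) (hj : j < m) : g ^ i = g ^ j ↔ i = j :=
    ⟨fun h => pow_injOn_Iio_orderOf hi hj h, fun h => h ▸ rfl⟩
  have hinner (x : G) : (∑ j ∈ Finset.range m, if g ^ j * (x * g) = x then (z ^ j)⁻¹ else 0) =
      (if x * g * x⁻¹ = g then z else 0) + (if x * g * x⁻¹ = g⁻¹ then z⁻¹ else 0) := by
    have hiff (j : ℕ) : g ^ j * (x * g) = x ↔ x * g * x⁻¹ = (g ^ j)⁻¹ := by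
      rw [mul_inv_eq_iff_eq_mul, eq_inv_mul_iff_mul_eq]
    simp only [hiff]
    by_cases h1 : x * g * x⁻¹ = g
    · have (j : ℕ) (hj : j ∈ Finset.range m) : g = (g ^ j)⁻¹ ↔ j = m - 1 := by
        rw [← inv_eq_iff_eq_inv, eq_comm, ← hginv, hinj (Finset.mem_range.1 hj) (by lia)]
      simp only [h1]
      rw [Finset.sum_congr rfl fun j hj => if_congr (this j hj) rfl rfl]
      simp [hne, hzinv, Nat.pos_of_ne_zero hm0]
    by_cases h2 : x * g * x⁻¹ = g⁻¹
    · have (j : ℕ) (hj : j ∈ Finset.range m) : g⁻¹ = (g ^ j)⁻¹ ↔ j = 1 := by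
        rw [inv_inj, eq_comm, ← hinj (Finset.mem_range.1 hj) (by lia : 1 < m), pow_one]
      simp only [h2]
      rw [Finset.sum_congr rfl fun j hj => if_congr (this j hj) rfl rfl]
      have h1m : 1 < m := by lia
      simp [hne.symm, h1m.not_ge]
    · rw [if_neg h1, if_neg h2, add_zero]
      refine Finset.sum_eq_zero fun j hj => if_neg fun hj' => ?_
      have hcompl : (g ^ j)⁻¹ = g ^ (m - j) := by
        rw [inv_eq_iff_mul_eq_one, ← pow_add, Nat.add_sub_cancel' (Finset.mem_range.1 hj).le, hgm]
      rw [hcompl] at hj'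
      rcases hpow x _ hj' with h | h
      · exact h1 (hj'.trans h)
      · exact h2 (hj'.trans h)
  have hsymm : (∑ x : G, if x * g * x⁻¹ = g⁻¹ then z⁻¹ else 0) =
      ∑ x : G, if x * g * x⁻¹ = g then z⁻¹ else 0 := by
    rw [← Fintype.sum_equiv (Equiv.mulLeft h) _ _ fun _ => rfl]
    refine Finset.sum_congr rfl fun x _ => if_congr ?_ rfl rfl
    have : h * x * g * (h * x)⁻¹ = h * (x * g * x⁻¹) * h⁻¹ := by group
    rw [← hreal, Equiv.coe_mulLeft, this, mul_left_inj, mul_right_inj]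
  have htrace := trace_mem_charFieldAt g _ (equivariantFunctions g z).toRepresentation
  rw [trace_equivariantFunctions hm0 hgm hζ.pow_eq_one] at htrace
  simp only [hinner] at htrace
  set c := (Finset.univ.filter fun x : G => x * g * x⁻¹ = g).card
  rw [Finset.sum_add_distrib, hsymm, ← Finset.sum_filter, ← Finset.sum_filter, Finset.sum_const,
    Finset.sum_const, ← smul_add, nsmul_eq_mul] at htrace
  have hc : (c : ℂ) ≠ 0 := by
    rw [Nat.cast_ne_zero]
    exact Finset.card_ne_zero_of_mem (a := 1) (by simp)
  have hm' : (m : ℂ) ≠ 0 := Nat.cast_ne_zero.2 hm0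
  have hres := mul_mem (mul_mem (natCast_mem _ m) (inv_mem (natCast_mem _ c))) htrace
  have heq : (m : ℂ) * (c : ℂ)⁻¹ * ((m : ℂ)⁻¹ * (c * (z + z⁻¹))) = z + z⁻¹ := by
    field_simp
  rwa [heq] at hres

end CharacterFields

namespace Matrix.SpecialLinearGroup

variable {F : Type*} [Field F]

theorem coe_add_coe_inv (g : SpecialLinearGroup (Fin 2) F) :
    (g : Matrix (Fin 2) (Fin 2) F) + (g⁻¹ : SpecialLinearGroup (Fin 2) F) =
      (g : Matrix (Fin 2) (Fin 2) F).trace • 1 := by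
  rw [coe_inv, adjugate_fin_two, trace_fin_two]
  ext i j
  fin_cases i <;> fin_cases j <;> simp [add_comm]

variable [CharP F 2]

/-- In characteristic two every element of `SL₂` is conjugate to its inverse, provided that
square roots exist. -/
theorem exists_conj_eq_inv (hsq : ∀ a : F, IsSquare a) (g : SpecialLinearGroup (Fin 2) F) :
    ∃ h : SpecialLinearGroup (Fin 2) F, h * g * h⁻¹ = g⁻¹ := by
  have h2 : (2 : F) = 0 := CharTwo.two_eq_zero
  suffices ∃ x y z : F, x ^ 2 - y * z = 1 ∧ x * (g 0 0 + g 1 1) + y * g 1 0 + z * g 0 1 = 0 by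
    obtain ⟨x, y, z, hdet, htr⟩ := this
    let h : SpecialLinearGroup (Fin 2) F :=
      ⟨!![x, y; z, x], by rw [det_fin_two_of]; linear_combination hdet⟩
    refine ⟨h, mul_inv_eq_iff_eq_mul.2 ?_⟩
    ext i j
    rw [coe_mul, coe_mul, coe_inv, adjugate_fin_two]
    fin_cases i <;> fin_cases j <;> simp [h, Matrix.mul_apply, Fin.sum_univ_two]
    · linear_combination htr - (x * g 1 1) * h2
    · linear_combination x * g 0 1 * h2
    · linear_combination x * g 1 0 * h2
    · linear_combination htr - (x * g 0 0) * h2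
  by_cases hb : g 0 1 = 0
  · by_cases hc : g 1 0 = 0
    · exact ⟨0, 1, 1, by linear_combination -h2, by simp [hb, hc]⟩
    · refine ⟨1, (g 0 0 + g 1 1) / g 1 0, 0, by simp, ?_⟩
      field_simp
      linear_combination (g 0 0 + g 1 1) * h2
  by_cases hc : g 1 0 = 0
  · refine ⟨1, 0, (g 0 0 + g 1 1) / g 0 1, by simp, ?_⟩
    field_simp
    linear_combination (g 0 0 + g 1 1) * h2
  obtain ⟨s, hs⟩ := hsq (g 0 1 * g 1 0)
  have hs0 : s ≠ 0 := by
    rintro rfl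
    simp [hb, hc] at hs
  refine ⟨0, g 0 1 / s, g 1 0 / s, ?_, ?_⟩
  · field_simp
    linear_combination -hs - s ^ 2 * h2
  · field_simp
    linear_combination g 0 1 * g 1 0 * h2

theorem sq_eq_one_of_trace_eq_zero {g : SpecialLinearGroup (Fin 2) F}
    (h : (g : Matrix (Fin 2) (Fin 2) F).trace = 0) : g ^ 2 = 1 := by
  have hinv := coe_add_coe_inv g
  rw [h, zero_smul, ← CharTwo.sub_eq_add, sub_eq_zero] at hinv
  rw [pow_two, ← eq_inv_iff_mul_eq_one]
  exact Subtype.ext hinv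

theorem sq_mul_inv_eq_one_of_det_sub_eq_zero {g h : SpecialLinearGroup (Fin 2) F}
    (hdet : (h - g : Matrix (Fin 2) (Fin 2) F).det = 0) : (g * h⁻¹) ^ 2 = 1 := by
  apply sq_eq_one_of_trace_eq_zero
  have h2 : (2 : F) = 0 := CharTwo.two_eq_zero
  have hg := g.det_coe
  have hh := h.det_coe
  simp only [det_fin_two, sub_apply] at hdet hg hh
  rw [coe_mul, coe_inv, adjugate_fin_two, trace_fin_two]
  simp [Matrix.mul_apply, Fin.sum_univ_two]
  linear_combination hg + hh - hdet + h2

theorem eq_of_det_sub_eq_zero {g h : SpecialLinearGroup (Fin 2) F} {m : ℕ} (hodd : Odd m)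
    (hcomm : Commute g h) (hg : g ^ m = 1) (hh : h ^ m = 1)
    (hdet : (h - g : Matrix (Fin 2) (Fin 2) F).det = 0) : h = g := by
  have h1 : (g * h⁻¹) ^ m = 1 := by rw [hcomm.inv_right.mul_pow, inv_pow, hg, hh, inv_one, one_mul]
  have h3 := (pow_gcd_eq_one (m := m) (n := 2)).2 ⟨h1, sq_mul_inv_eq_one_of_det_sub_eq_zero hdet⟩
  rw [Nat.Coprime.gcd_eq_one hodd.coprime_two_right, pow_one] at h3
  exact (mul_inv_eq_one.1 h3).symm

/-- An element of odd order of `SL₂` in characteristic two is conjugate to none of its powers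
other than itself and its inverse. -/
theorem pow_eq_or_eq_inv_of_conj {g x : SpecialLinearGroup (Fin 2) F} (hodd : Odd (orderOf g))
    {j : ℕ} (hx : x * g * x⁻¹ = g ^ j) : g ^ j = g ∨ g ^ j = g⁻¹ := by
  have hcomm : Commute g (g ^ j) := Commute.self_pow g j
  have hgm := pow_orderOf_eq_one g
  have hhm : (g ^ j) ^ orderOf g = 1 := by rw [← pow_mul', pow_mul, hgm, one_pow]
  generalize g ^ j = h at *
  have htrace : (h : Matrix (Fin 2) (Fin 2) F).trace = (g : Matrix (Fin 2) (Fin 2) F).trace := by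
    rw [← hx, coe_mul, coe_mul, trace_mul_cycle, ← coe_mul x⁻¹ x, inv_mul_cancel, coe_one, one_mul]
  have hsum : (g : Matrix (Fin 2) (Fin 2) F) + (g⁻¹ : SpecialLinearGroup (Fin 2) F) =
      h + (h⁻¹ : SpecialLinearGroup (Fin 2) F) := by
    rw [coe_add_coe_inv, coe_add_coe_inv, htrace]
  have hprod : (h - g : Matrix (Fin 2) (Fin 2) F) *
      (h - (g⁻¹ : SpecialLinearGroup (Fin 2) F) : Matrix (Fin 2) (Fin 2) F) = 0 := by
    have hgh : (g : Matrix (Fin 2) (Fin 2) F) * h = h * g := congrArg Subtype.val hcomm.eq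
    have hg1 : (g : Matrix (Fin 2) (Fin 2) F) * (g⁻¹ : SpecialLinearGroup (Fin 2) F) = 1 := by
      rw [← coe_mul, mul_inv_cancel, coe_one]
    have hh1 : (h : Matrix (Fin 2) (Fin 2) F) * (h⁻¹ : SpecialLinearGroup (Fin 2) F) = 1 := by
      rw [← coe_mul, mul_inv_cancel, coe_one]
    have := congrArg ((h : Matrix (Fin 2) (Fin 2) F) * ·) hsum
    simp only [mul_add, hh1] at this
    rw [sub_mul, mul_sub, mul_sub, hgh, hg1, ← sub_eq_zero.2 this.symm]
    abel
  have hdet := congrArg det hprod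
  rw [det_mul, det_zero, mul_eq_zero] at hdet
  refine hdet.imp (eq_of_det_sub_eq_zero hodd hcomm hgm hhm)
    (eq_of_det_sub_eq_zero hodd hcomm.inv_left ?_ hhm)
  rw [inv_pow, hgm, inv_one]

/-- In characteristic two the only elements of `SL₂` of `2`-power order are involutions. -/
theorem sq_eq_one_of_pow_two_pow_eq_one {g : SpecialLinearGroup (Fin 2) F} {r : ℕ}
    (hg : g ^ 2 ^ r = 1) : g ^ 2 = 1 := by
  have h2 : (2 : F) = 0 := CharTwo.two_eq_zero
  have hnil : (g.1 - 1) ^ 2 ^ r = 0 := by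
    rw [sub_pow_char_pow_of_commute _ _ (Commute.one_right _), one_pow, ← coe_pow, hg]
    simp
  have hdet : (g.1 - 1).det = 0 := by
    refine eq_zero_of_pow_eq_zero (n := 2 ^ r) ?_
    rw [← det_pow, hnil, det_zero]
  have := sq_mul_inv_eq_one_of_det_sub_eq_zero (g := 1) (h := g) hdet
  rwa [one_mul, inv_pow, inv_eq_one] at this

end Matrix.SpecialLinearGroup

theorem zeta_two : zeta 2 = -1 :=
  (zeta_isPrimitiveRoot two_ne_zero).eq_neg_one_of_two_right

/-- For `q = 2^n`, if `SL_2(F_q)` contains an element of order `ℓ^r`, then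
`K_{ℓ^r}(SL_2(F_q)) = ℚ(ζ_{ℓ^r} + ζ_{ℓ^r}^{−1})` when `q ≡ ±1 (mod ℓ^r)`, and
`K_{ℓ^r}(SL_2(F_q)) = ℚ` when `q ≡ 0 (mod ℓ^r)`. -/
theorem statement8 (n q ℓ r : ℕ) (hn : 1 ≤ n) (hq : q = 2 ^ n)
    (hℓ : ℓ.Prime) (hr : 1 ≤ r)
    (F : Type) [Field F] [Fintype F] (hF : Fintype.card F = q)
    (hex : ∃ g : Matrix.SpecialLinearGroup (Fin 2) F, orderOf g = ℓ ^ r) :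
    (((q : ZMod (ℓ ^ r)) = 1 ∨ (q : ZMod (ℓ ^ r)) = -1) →
      charFieldAt (Matrix.SpecialLinearGroup (Fin 2) F) (ℓ ^ r) =
        IntermediateField.adjoin ℚ {zeta (ℓ ^ r) + (zeta (ℓ ^ r))⁻¹}) ∧
    ((q : ZMod (ℓ ^ r)) = 0 →
      charFieldAt (Matrix.SpecialLinearGroup (Fin 2) F) (ℓ ^ r) = ⊥) := by
  have hcard : Fintype.card F = 2 ^ n := hF.trans hq
  have hchar : CharP F 2 := charP_of_card_eq_prime_pow hcard
  have hm0 : ℓ ^ r ≠ 0 := (pow_pos hℓ.pos r).ne'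
  have hle := charFieldAt_le hm0 fun (g : Matrix.SpecialLinearGroup (Fin 2) F) _ =>
    g.exists_conj_eq_inv fun a => FiniteField.isSquare_of_char_two (ringChar.eq F 2) a
  have hq2 : 2 ∣ q := hq ▸ dvd_pow_self 2 (by lia)
  refine ⟨fun hpm => le_antisymm hle ?_, fun h0 => ?_⟩
  · have hodd : Odd (ℓ ^ r) := by
      rw [← Nat.not_even_iff_odd, even_iff_two_dvd]
      intro h2
      have h1 : (q : ZMod 2) = 1 := by
        let φ := ZMod.castHom h2 (ZMod 2)
        rcases hpm with h | h
        · rw [← map_natCast φ, h, map_one]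
        · rw [← map_natCast φ, h, map_neg, map_one, ZMod.neg_eq_self_mod_two]
      rw [(ZMod.natCast_eq_zero_iff q 2).2 hq2] at h1
      exact zero_ne_one h1
    obtain ⟨g, hg⟩ := hex
    obtain ⟨h, hh⟩ := g.exists_conj_eq_inv fun a =>
      FiniteField.isSquare_of_char_two (ringChar.eq F 2) a
    have h2 : 2 < orderOf g := by
      have h1 : 1 < ℓ ^ r := Nat.one_lt_pow (by lia) hℓ.one_lt
      have : ℓ ^ r ≠ 2 := fun h => absurd (h ▸ hodd) (by decide)
      lia
    rw [IntermediateField.adjoin_le_iff, Set.singleton_subset_iff, SetLike.mem_coe, ← hg]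
    refine zeta_add_inv_mem_charFieldAt h2 hh fun x j =>
      Matrix.SpecialLinearGroup.pow_eq_or_eq_inv_of_conj (hg ▸ hodd)
  · have hℓ2 : ℓ = 2 := by
      rw [ZMod.natCast_eq_zero_iff, hq] at h0
      exact (Nat.prime_dvd_prime_iff_eq hℓ Nat.prime_two).1
        (hℓ.dvd_of_dvd_pow ((dvd_pow_self ℓ (by lia)).trans h0))
    obtain ⟨g, hg⟩ := hex
    have hm2 : ℓ ^ r = 2 := by
      subst hℓ2
      have hdvd := orderOf_dvd_of_pow_eq_one
        (g.sq_eq_one_of_pow_two_pow_eq_one (r := r) (hg ▸ pow_orderOf_eq_one g))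
      rw [hg] at hdvd
      exact Nat.dvd_antisymm hdvd (dvd_pow_self 2 (by lia))
    rw [hm2, zeta_two] at hle
    rw [hm2, eq_bot_iff]
    refine hle.trans (IntermediateField.adjoin_le_iff.2 (Set.singleton_subset_iff.2 ?_))
    exact add_mem (neg_mem (one_mem _)) (inv_mem (neg_mem (one_mem _)))
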